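/- Let A be a nonnegative random variable whose law has a continuous density a on (0,∞), and let (U,V) be a random vector, independent of A, taking values in (0,∞)² and whose law has a continuous density f on (0,∞)² with respect to two-dimensional Lebesgue measure. Assume that A·U + V has the same distribution as A, that there exist constants c > 0 and ρ > 0 with lim_{R→∞} R^ρ · P(A > R) = c/ρ, and that E[U^ρ] = 1. Then liminf_{r→∞} r^{ρ+1} a(r) ≥ c. -/

import Mathlib

open MeasureTheory ProbabilityTheory Filter

noncomputable def idx (N : ℝ) (p : ℝ × ℝ) : ℕ × ℕ := (⌊p.1 * N⌋₊, ⌊p.2 * N⌋₊)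

noncomputable def mm (f : ℝ × ℝ → ℝ) (N : ℝ) (i : ℕ × ℕ) : ENNReal :=
  ⨅ q, ⨅ (_ : idx N q = i), ENNReal.ofReal (f q)

lemma idx_meas (N : ℝ) : Measurable (idx N) := by
  unfold idx
  exact ((Nat.measurable_floor.comp (measurable_fst.mul_const N)).prodMk
    (Nat.measurable_floor.comp (measurable_snd.mul_const N)))

lemma mm_le (f : ℝ × ℝ → ℝ) (N : ℝ) (p : ℝ × ℝ) : mm f N (idx N p) ≤ ENNReal.ofReal (f p) :=
  iInf₂_le (f := fun q (_ : idx N q = idx N p) => ENNReal.ofReal (f q)) p rfl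

def QQ : Set (ℝ × ℝ) := Set.Ioi 0 ×ˢ Set.Ioi 0

lemma QQ_meas : MeasurableSet QQ := measurableSet_Ioi.prod measurableSet_Ioi

/-- density as lintegral -/
lemma dens_lint {X : Type*} [MeasurableSpace X] (μ ν : Measure X) [IsProbabilityMeasure ν]
    (f : X → ℝ) (hf_nn : ∀ p, 0 ≤ f p) (Q : Set X)
    (h : ∀ B : Set X, MeasurableSet B → ν B = ENNReal.ofReal (∫ p in B ∩ Q, f p ∂μ)) :
    IntegrableOn f Q μ ∧ ∀ B : Set X, MeasurableSet B →
      ν B = ∫⁻ p in B ∩ Q, ENNReal.ofReal (f p) ∂μ := by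
  have h1 : IntegrableOn f Q μ := by
    by_contra hc
    have := h Set.univ MeasurableSet.univ
    rw [Set.univ_inter, integral_undef hc] at this
    simp at this
  refine ⟨h1, fun B hB => ?_⟩
  rw [h B hB, ofReal_integral_eq_lintegral_ofReal (h1.mono_set Set.inter_subset_right)
    (Eventually.of_forall hf_nn)]

lemma lint_idx (N : ℝ) (g : ℕ × ℕ → ENNReal) (μ : Measure (ℝ × ℝ)) :
    ∫⁻ p, g (idx N p) ∂μ = ∑' i, g i * μ (idx N ⁻¹' {i}) := by
  rw [← lintegral_map (f := g) (g := idx N) (measurable_of_countable g) (idx_meas N), lintegral_countable']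
  congr 1
  ext i
  rw [Measure.map_apply (idx_meas N) (measurableSet_singleton i)]

def JJ (N : ℝ) (i : ℕ × ℕ) (r : ℝ) : Set ℝ :=
  Set.Ioc ((r + 1 - i.2 / N) / ((i.1 + 1) / N)) ((r - (i.2 + 1) / N) / (i.1 / N))

lemma JJ_meas (N : ℝ) (i : ℕ × ℕ) (r : ℝ) : MeasurableSet (JJ N i r) := measurableSet_Ioc

lemma box_vol (N : ℝ) (hN : 0 < N) (i : ℕ × ℕ) (r η s : ℝ) (hr : 0 < r) (hη : 0 < η) (hη1 : η ≤ 1)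
    (hs : 0 < s) (hJ : s ∈ JJ N i r) :
    ENNReal.ofReal η * ENNReal.ofReal ((i.1 / N) / (N * r)) ≤
      volume (idx N ⁻¹' {i} ∩ ({p : ℝ × ℝ | s * p.1 + p.2 ∈ Set.Ioc r (r + η)} ∩ QQ)) := by
  obtain ⟨k, l⟩ := i
  simp only [JJ, Set.mem_Ioc] at hJ
  rcases Nat.eq_zero_or_pos k with rfl | hk
  · simp
  have hk' : (0:ℝ) < k := by exact_mod_cast hk
  have hα : 0 < (k:ℝ) / N := by positivity
  obtain ⟨hJ1, hJ2⟩ := hJ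
  rw [div_lt_iff₀ (by positivity)] at hJ1
  rw [le_div_iff₀ hα] at hJ2
  have hγ : 0 ≤ (l:ℝ) / N := by positivity
  let T : Set (ℝ × ℝ) := {p | p.2 ∈ Set.Ioo ((l:ℝ) / N) ((l + 1) / N) ∧
    p.1 ∈ Set.Ioc ((r - p.2) / s) ((r + η - p.2) / s)}
  have hTm : MeasurableSet T := by
    have e1 : MeasurableSet {p : ℝ × ℝ | p.2 ∈ Set.Ioo ((l:ℝ) / N) ((l + 1) / N)} :=
      measurable_snd measurableSet_Ioo
    have e2 : MeasurableSet {p : ℝ × ℝ | (r - p.2) / s < p.1} :=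
      measurableSet_lt (by fun_prop) (by fun_prop)
    have e3 : MeasurableSet {p : ℝ × ℝ | p.1 ≤ (r + η - p.2) / s} :=
      measurableSet_le (by fun_prop) (by fun_prop)
    exact e1.inter (e2.inter e3)
  have hsub : T ⊆ (idx N ⁻¹' {(k, l)} ∩ ({p : ℝ × ℝ | s * p.1 + p.2 ∈ Set.Ioc r (r + η)} ∩ QQ)) := by
    rintro ⟨u, v⟩ ⟨⟨hv1, hv2⟩, hu1, hu2⟩
    simp only at hv1 hv2 hu1 hu2
    rw [div_lt_iff₀ hs] at hu1
    rw [le_div_iff₀ hs] at hu2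
    have ha : (k:ℝ) / N < u := by
      by_contra! hcon
      nlinarith [mul_le_mul_of_nonneg_right hcon hs.le]
    have hb : u < ((k:ℝ) + 1) / N := by
      by_contra! hcon
      nlinarith [mul_le_mul_of_nonneg_right hcon hs.le]
    refine ⟨?_, ?_, ?_, ?_⟩
    · have hu0 : 0 < u := hα.trans ha
      have hv0 : 0 < v := hγ.trans_lt hv1
      simp only [idx, Set.mem_preimage, Set.mem_singleton_iff, Prod.mk.injEq]
      rw [div_lt_iff₀ hN] at ha hv1
      rw [lt_div_iff₀ hN] at hb hv2
      rw [Nat.floor_eq_iff (by positivity), Nat.floor_eq_iff (by positivity)]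
      exact ⟨⟨ha.le, hb⟩, hv1.le, hv2⟩
    · simp only [Set.mem_Ioc, Set.mem_ofPred_eq]
      constructor <;> linarith
    · exact hα.trans ha
    · exact hγ.trans_lt hv1
  refine le_trans ?_ (measure_mono hsub)
  rw [Measure.volume_eq_prod, Measure.prod_apply_symm hTm]
  calc ENNReal.ofReal η * ENNReal.ofReal ((k / N) / (N * r))
      ≤ ENNReal.ofReal (η / s) * volume (Set.Ioo ((l:ℝ) / N) ((l + 1) / N)) := by
        rw [Real.volume_Ioo, ← ENNReal.ofReal_mul hη.le, ← ENNReal.ofReal_mul (by positivity)]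
        apply ENNReal.ofReal_le_ofReal
        have hδ : 0 ≤ ((l:ℝ) + 1) / N := by positivity
        have e : ((l:ℝ) + 1) / N - l / N = 1 / N := by ring
        rw [e, div_mul_eq_mul_div, le_div_iff₀ hs]
        have : η * ((k:ℝ) / N / (N * r)) * s = η * (1 / N) * ((s * (k / N)) / r) := by
          field_simp
        rw [this]
        apply mul_le_of_le_one_right (by positivity)
        rw [div_le_one hr]; linarith
    _ = ∫⁻ v in Set.Ioo ((l:ℝ) / N) ((l + 1) / N), ENNReal.ofReal (η / s) := by
        rw [setLIntegral_const]
    _ ≤ ∫⁻ v in Set.Ioo ((l:ℝ) / N) ((l + 1) / N), volume ((fun u => (u, v)) ⁻¹' T) := by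
        apply setLIntegral_mono' measurableSet_Ioo
        intro v hv
        have : (fun u => (u, v)) ⁻¹' T = Set.Ioc ((r - v) / s) ((r + η - v) / s) := by
          ext u
          simp only [T, Set.mem_preimage, Set.mem_ofPred_eq]
          exact ⟨fun h => h.2, fun h => ⟨hv, h⟩⟩
        rw [this, Real.volume_Ioc]
        apply ENNReal.ofReal_le_ofReal
        apply le_of_eq; ring
    _ ≤ _ := setLIntegral_le_lintegral _ _

lemma law_lower (μA : Measure ℝ) (ν : Measure (ℝ × ℝ)) [IsProbabilityMeasure μA]
    [IsProbabilityMeasure ν] (f : ℝ × ℝ → ℝ)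
    (hν : ∀ B : Set (ℝ × ℝ), MeasurableSet B → ν B = ∫⁻ p in B ∩ QQ, ENNReal.ofReal (f p))
    (hpos : ∀ᵐ s ∂μA, 0 < s)
    (hfix : Measure.map (fun q : ℝ × (ℝ × ℝ) => q.1 * q.2.1 + q.2.2) (μA.prod ν) = μA)
    (N : ℝ) (hN : 0 < N) (r η : ℝ) (hr : 0 < r) (hη : 0 < η) (hη1 : η ≤ 1) :
    ENNReal.ofReal η * ∑' i, mm f N i * (ENNReal.ofReal ((i.1 / N) / (N * r)) * μA (JJ N i r)) ≤
      μA (Set.Ioc r (r + η)) := by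
  have hm : Measurable (fun q : ℝ × (ℝ × ℝ) => q.1 * q.2.1 + q.2.2) := by fun_prop
  conv_rhs => rw [← hfix]
  rw [Measure.map_apply hm measurableSet_Ioc, Measure.prod_apply (hm measurableSet_Ioc)]
  calc _ = ∫⁻ s, ∑' i, mm f N i * (JJ N i r).indicator (fun _ => ENNReal.ofReal η *
            ENNReal.ofReal ((i.1 / N) / (N * r))) s ∂μA := by
        rw [lintegral_tsum]
        · rw [← ENNReal.tsum_mul_left]
          congr 1; ext i
          rw [lintegral_const_mul _ (measurable_const.indicator (JJ_meas N i r)),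
            lintegral_indicator_const (JJ_meas N i r)]
          ring
        · intro i
          exact ((measurable_const.indicator (JJ_meas N i r)).const_mul _).aemeasurable
    _ ≤ _ := by
        apply lintegral_mono_ae
        filter_upwards [hpos] with s hs
        set S : Set (ℝ × ℝ) := {p : ℝ × ℝ | s * p.1 + p.2 ∈ Set.Ioc r (r + η)} with hS
        have hSm : MeasurableSet S := by
          have : Measurable (fun p : ℝ × ℝ => s * p.1 + p.2) := by fun_prop
          exact this measurableSet_Ioc
        have e : Prod.mk s ⁻¹' ((fun q : ℝ × (ℝ × ℝ) => q.1 * q.2.1 + q.2.2) ⁻¹' Set.Ioc r (r + η)) = S := rfl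
        rw [e, hν S hSm]
        calc _ ≤ ∑' i, mm f N i * (volume.restrict (S ∩ QQ)) (idx N ⁻¹' {i}) := by
              apply ENNReal.tsum_le_tsum
              intro i
              gcongr
              by_cases hJ : s ∈ JJ N i r
              · rw [Set.indicator_of_mem hJ, Measure.restrict_apply (idx_meas N (measurableSet_singleton i))]
                exact box_vol N hN i r η s hr hη hη1 hs hJ
              · rw [Set.indicator_of_notMem hJ]; exact zero_le
          _ = ∫⁻ p in S ∩ QQ, mm f N (idx N p) := (lint_idx N _ _).symm
          _ ≤ _ := lintegral_mono fun p => mm_le f N p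

lemma dens_lower (μA : Measure ℝ) (a : ℝ → ℝ) (ha_cont : ContinuousOn a (Set.Ioi 0))
    (hμ : ∀ B : Set ℝ, MeasurableSet B → μA B = ∫⁻ p in B ∩ Set.Ioi 0, ENNReal.ofReal (a p))
    (r : ℝ) (hr : 0 < r) (K : ENNReal)
    (h : ∀ η : ℝ, 0 < η → η ≤ 1 → ENNReal.ofReal η * K ≤ μA (Set.Ioc r (r + η))) :
    K ≤ ENNReal.ofReal (a r) := by
  refine le_of_forall_gt fun y hy => ?_
  obtain ⟨z, hz1, hz2⟩ := exists_between hy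
  refine lt_of_le_of_lt ?_ hz2
  have hc : ContinuousAt (fun x => ENNReal.ofReal (a x)) r :=
    (ENNReal.continuous_ofReal.continuousAt).comp (ha_cont.continuousAt (Ioi_mem_nhds hr))
  have hev := hc.eventually_lt_const hz1
  obtain ⟨ε, hε, hb⟩ := Metric.eventually_nhds_iff.1 hev
  set η := min 1 (ε / 2) with hηd
  have hη : 0 < η := by positivity
  have h1 := h η hη (min_le_left _ _)
  have h2 : μA (Set.Ioc r (r + η)) ≤ ENNReal.ofReal η * z := by
    rw [hμ _ measurableSet_Ioc]
    calc _ ≤ ∫⁻ p in Set.Ioc r (r + η), ENNReal.ofReal (a p) :=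
          lintegral_mono_set Set.inter_subset_left
      _ ≤ ∫⁻ p in Set.Ioc r (r + η), z := by
          apply setLIntegral_mono' measurableSet_Ioc
          intro x hx
          refine (hb ?_).le
          rw [Real.dist_eq, abs_of_pos (by linarith [hx.1])]
          have := min_le_right 1 (ε / 2)
          linarith [hx.2]
      _ = _ := by
          rw [setLIntegral_const, Real.volume_Ioc, mul_comm]; simp
  exact (ENNReal.mul_le_mul_iff_right (by simpa using hη) ENNReal.ofReal_ne_top).1 (h1.trans h2)

lemma tail_scale (t : ℝ → ℝ) (κ ρ : ℝ)
    (htail : Tendsto (fun R : ℝ => R ^ ρ * t R) atTop (nhds κ)) (b d : ℝ) (hb : 0 < b) :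
    Tendsto (fun r : ℝ => r ^ ρ * t ((r + d) / b)) atTop (nhds (κ * b ^ ρ)) := by
  have hR : Tendsto (fun r : ℝ => (r + d) / b) atTop atTop :=
    (tendsto_atTop_add_const_right _ d tendsto_id).atTop_div_const hb
  have h1 := htail.comp hR
  have h2 : Tendsto (fun r : ℝ => r / ((r + d) / b)) atTop (nhds b) := by
    have h3 : Tendsto (fun r : ℝ => b - (b * d) * (r + d)⁻¹) atTop (nhds (b - (b * d) * 0)) :=
      tendsto_const_nhds.sub (tendsto_const_nhds.mul
        (tendsto_inv_atTop_zero.comp (tendsto_atTop_add_const_right _ d tendsto_id)))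
    simp only [mul_zero, sub_zero] at h3
    refine h3.congr' ?_
    filter_upwards [eventually_gt_atTop (-d)] with r hr
    have : r + d ≠ 0 := by linarith
    field_simp
    ring
  have h4 := h1.mul (h2.rpow_const (p := ρ) (Or.inl hb.ne'))
  refine h4.congr' ?_
  filter_upwards [eventually_gt_atTop (-d), eventually_gt_atTop 0] with r hr hr0
  have : 0 < r + d := by linarith
  have hp : 0 < (r + d) / b := by positivity
  simp only [Function.comp]
  rw [Real.div_rpow hr0.le hp.le]
  have : ((r + d) / b) ^ ρ ≠ 0 := (Real.rpow_pos_of_pos hp ρ).ne'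
  field_simp

noncomputable def HH (c ρ N : ℝ) (i : ℕ × ℕ) : ℝ :=
  c / ρ * (((i.1 + 1) / N) ^ ρ - (i.1 / N) ^ ρ)

lemma mm_ne_top (f : ℝ × ℝ → ℝ) (N : ℝ) (hN : 0 < N) (i : ℕ × ℕ) : mm f N i ≠ ⊤ := by
  have h : idx N ((i.1 : ℝ) / N, (i.2 : ℝ) / N) = i := by
    simp [idx, div_mul_cancel₀ _ hN.ne']
  have := mm_le f N ((i.1 : ℝ) / N, (i.2 : ℝ) / N)
  rw [h] at this
  exact ne_top_of_le_ne_top ENNReal.ofReal_ne_top this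

lemma term_lim (μA : Measure ℝ) [IsProbabilityMeasure μA] (c ρ : ℝ)
    (htail : Tendsto (fun R : ℝ => R ^ ρ * μA.real (Set.Ioi R)) atTop (nhds (c / ρ)))
    (N : ℝ) (hN : 0 < N) (i : ℕ × ℕ) :
    ∃ h : ℝ → ENNReal, (∀ r, 0 < r → h r ≤ ENNReal.ofReal (r ^ (ρ + 1)) *
        (ENNReal.ofReal ((i.1 / N) / (N * r)) * μA (JJ N i r))) ∧
      Tendsto h atTop (nhds (ENNReal.ofReal (i.1 / N) *
        (ENNReal.ofReal (1 / N) * ENNReal.ofReal (HH c ρ N i)))) := by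
  obtain ⟨k, l⟩ := i
  rcases Nat.eq_zero_or_pos k with rfl | hk
  · exact ⟨fun _ => 0, by simp, by simp⟩
  have hk' : (0:ℝ) < k := by exact_mod_cast hk
  have hα : 0 < (k:ℝ) / N := by positivity
  have hβ : 0 < ((k:ℝ) + 1) / N := by positivity
  have t1 := tail_scale _ _ _ htail _ (1 - l / N) hβ
  have t2 := tail_scale _ _ _ htail _ (- ((l + 1) / N)) hα
  have t3 := (ENNReal.continuous_ofReal.tendsto _).comp (t1.sub t2)
  refine ⟨fun r => ENNReal.ofReal (k / N) * (ENNReal.ofReal (1 / N) * ENNReal.ofReal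
    (r ^ ρ * μA.real (Set.Ioi ((r + (1 - l / N)) / ((k + 1) / N))) -
      r ^ ρ * μA.real (Set.Ioi ((r + (- ((l + 1) / N))) / (k / N))))), fun r hr => ?_, ?_⟩
  · have hJ : μA.real (Set.Ioi ((r + (1 - l / N)) / ((k + 1) / N))) -
      μA.real (Set.Ioi ((r + (- ((l + 1) / N))) / (k / N))) ≤ μA.real (JJ N (k, l) r) := by
      rw [sub_le_iff_le_add]
      refine le_trans (measureReal_mono ?_) (measureReal_union_le _ _)
      intro x hx
      by_cases h : x ≤ (r - (l + 1) / N) / (k / N)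
      · left
        refine ⟨?_, h⟩
        have e : r + 1 - (l:ℝ) / N = r + (1 - l / N) := by ring
        simp only [e]; exact hx
      · right
        rw [← sub_eq_add_neg]; exact not_le.1 h
    beta_reduce
    rw [← ofReal_measureReal, ← ENNReal.ofReal_mul (by positivity), ← ENNReal.ofReal_mul (by positivity),
      ← ENNReal.ofReal_mul (by positivity), ← ENNReal.ofReal_mul (by positivity)]
    apply ENNReal.ofReal_le_ofReal
    rw [Real.rpow_add hr, Real.rpow_one, ← mul_sub]
    calc _ ≤ (k:ℝ) / N * (1 / N * (r ^ ρ * μA.real (JJ N (k, l) r))) := by gcongr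
      _ = _ := by field_simp
  · refine ENNReal.Tendsto.const_mul (ENNReal.Tendsto.const_mul ?_ (Or.inr ENNReal.ofReal_ne_top))
      (Or.inr ENNReal.ofReal_ne_top)
    have e : HH c ρ N (k, l) = c / ρ * ((k + 1) / N) ^ ρ - c / ρ * (k / N) ^ ρ := by
      simp only [HH]; ring
    rw [e]
    exact t3

lemma sum_lim (μA : Measure ℝ) [IsProbabilityMeasure μA] (c ρ : ℝ) (f : ℝ × ℝ → ℝ)
    (htail : Tendsto (fun R : ℝ => R ^ ρ * μA.real (Set.Ioi R)) atTop (nhds (c / ρ)))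
    (N : ℝ) (hN : 0 < N) (x : ENNReal)
    (hx : x < ∑' i, mm f N i * (ENNReal.ofReal (i.1 / N) *
        (ENNReal.ofReal (1 / N) * ENNReal.ofReal (HH c ρ N i)))) :
    ∀ᶠ r : ℝ in atTop, x < ENNReal.ofReal (r ^ (ρ + 1)) *
      ∑' i, mm f N i * (ENNReal.ofReal ((i.1 / N) / (N * r)) * μA (JJ N i r)) := by
  choose h h1 h2 using term_lim μA c ρ htail N hN
  rw [ENNReal.tsum_eq_iSup_sum, lt_iSup_iff] at hx
  obtain ⟨s, hs⟩ := hx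
  have h3 : Tendsto (fun r => ∑ i ∈ s, mm f N i * h i r) atTop (nhds (∑ i ∈ s, mm f N i *
      (ENNReal.ofReal (i.1 / N) * (ENNReal.ofReal (1 / N) * ENNReal.ofReal (HH c ρ N i))))) :=
    tendsto_finsetSum _ fun i _ => ENNReal.Tendsto.const_mul (h2 i) (Or.inr (mm_ne_top f N hN i))
  filter_upwards [h3.eventually_const_lt hs, eventually_gt_atTop 0] with r hr hr0
  refine hr.trans_le ?_
  rw [← ENNReal.tsum_mul_left]
  refine le_trans (Finset.sum_le_sum fun i _ => ?_) (ENNReal.sum_le_tsum s)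
  calc _ ≤ mm f N i * (ENNReal.ofReal (r ^ (ρ + 1)) *
        (ENNReal.ofReal ((i.1 / N) / (N * r)) * μA (JJ N i r))) := by gcongr; exact h1 i r hr0
    _ = _ := by ring

lemma box_int (c ρ : ℝ) (hc : 0 < c) (hρ : 0 < ρ) (N : ℝ) (hN : 0 < N) (i : ℕ × ℕ) :
    ∫⁻ p in idx N ⁻¹' {i} ∩ QQ, ENNReal.ofReal (c * p.1 ^ (ρ - 1)) ≤
      ENNReal.ofReal (1 / N) * ENNReal.ofReal (HH c ρ N i) := by
  obtain ⟨k, l⟩ := i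
  have hα : 0 ≤ (k:ℝ) / N := by positivity
  have hαβ : (k:ℝ) / N ≤ (k + 1) / N := by gcongr; linarith
  calc _ ≤ ∫⁻ p in Set.Ico ((k:ℝ) / N) ((k + 1) / N) ×ˢ Set.Ico ((l:ℝ) / N) ((l + 1) / N),
        ENNReal.ofReal (c * p.1 ^ (ρ - 1)) := by
        apply lintegral_mono_set
        rintro ⟨u, v⟩ ⟨h, hu, hv⟩
        simp only [Set.mem_Ioi] at hu hv
        simp only [idx, Set.mem_preimage, Set.mem_singleton_iff, Prod.mk.injEq] at h
        rw [Nat.floor_eq_iff (by positivity), Nat.floor_eq_iff (by positivity)] at h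
        obtain ⟨⟨a1, a2⟩, a3, a4⟩ := h
        refine ⟨⟨?_, ?_⟩, ?_, ?_⟩
        · rwa [div_le_iff₀ hN]
        · rwa [lt_div_iff₀ hN]
        · rwa [div_le_iff₀ hN]
        · rwa [lt_div_iff₀ hN]
    _ = ENNReal.ofReal (1 / N) * ∫⁻ u in Set.Ico ((k:ℝ) / N) ((k + 1) / N),
          ENNReal.ofReal (c * u ^ (ρ - 1)) := by
        have hm : Measurable fun u : ℝ => ENNReal.ofReal (c * u ^ (ρ - 1)) := by fun_prop
        rw [Measure.volume_eq_prod, ← Measure.prod_restrict,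
          lintegral_prod (fun p : ℝ × ℝ => ENNReal.ofReal (c * p.1 ^ (ρ - 1)))
            (hm.comp measurable_fst).aemeasurable]
        simp only [lintegral_const, Measure.restrict_apply MeasurableSet.univ, Set.univ_inter,
          Real.volume_Ico]
        rw [lintegral_mul_const _ hm, mul_comm]
        congr 2; ring
    _ ≤ _ := by
        gcongr
        have hi : IntervalIntegrable (fun u : ℝ => c * u ^ (ρ - 1)) volume ((k:ℝ) / N) ((k + 1) / N) :=
          (intervalIntegral.intervalIntegrable_rpow' (by linarith)).const_mul c
        rw [intervalIntegrable_iff_integrableOn_Ioc_of_le hαβ] at hi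
        rw [setLIntegral_congr Ico_ae_eq_Ioc, ← ofReal_integral_eq_lintegral_ofReal hi]
        · apply ENNReal.ofReal_le_ofReal
          rw [← intervalIntegral.integral_of_le hαβ, intervalIntegral.integral_const_mul,
            integral_rpow (Or.inl (by linarith))]
          simp only [HH, sub_add_cancel]
          apply le_of_eq; ring
        · refine (ae_restrict_iff' measurableSet_Ioc).2 (Eventually.of_forall fun u hu => ?_)
          have : 0 ≤ u := hα.trans hu.1.le
          simp only [Pi.zero_apply]; positivity

lemma KK_lower (c ρ : ℝ) (hc : 0 < c) (hρ : 0 < ρ) (f : ℝ × ℝ → ℝ) (N : ℝ) (hN : 0 < N) :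
    ∫⁻ p in QQ, mm f N (idx N p) * ENNReal.ofReal ((idx N p).1 / N) *
        ENNReal.ofReal (c * p.1 ^ (ρ - 1)) ≤
      ∑' i, mm f N i * (ENNReal.ofReal (i.1 / N) *
        (ENNReal.ofReal (1 / N) * ENNReal.ofReal (HH c ρ N i))) := by
  have hm : Measurable fun p : ℝ × ℝ => ENNReal.ofReal (c * p.1 ^ (ρ - 1)) := by fun_prop
  have hg : Measurable fun p => mm f N (idx N p) * ENNReal.ofReal ((idx N p).1 / N) :=
    (measurable_of_countable (fun i : ℕ × ℕ => mm f N i * ENNReal.ofReal (i.1 / N))).comp (idx_meas N)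
  have e := lint_idx N (fun i : ℕ × ℕ => mm f N i * ENNReal.ofReal (i.1 / N))
    ((volume.restrict QQ).withDensity fun p : ℝ × ℝ => ENNReal.ofReal (c * p.1 ^ (ρ - 1)))
  rw [lintegral_withDensity_eq_lintegral_mul _ hm hg] at e
  calc _ = _ := by
        refine Eq.trans ?_ e
        apply lintegral_congr; intro p; simp only [Pi.mul_apply]; ring
    _ ≤ _ := by
        apply ENNReal.tsum_le_tsum; intro i
        rw [withDensity_apply _ (idx_meas N (measurableSet_singleton i)),
          Measure.restrict_restrict (idx_meas N (measurableSet_singleton i)), mul_assoc]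
        gcongr
        exact box_int c ρ hc hρ N hN i

lemma mm_lim (f : ℝ × ℝ → ℝ) (hf_cont : ContinuousOn f (Set.Ioi 0 ×ˢ Set.Ioi 0)) (p : ℝ × ℝ)
    (hp : p ∈ QQ) : Tendsto (fun N : ℝ => mm f N (idx N p)) atTop (nhds (ENNReal.ofReal (f p))) := by
  have hp1 : 0 < p.1 := hp.1
  have hp2 : 0 < p.2 := hp.2
  have hc : ContinuousAt (fun x => ENNReal.ofReal (f x)) p :=
    (ENNReal.continuous_ofReal.continuousAt).comp
      (hf_cont.continuousAt ((isOpen_Ioi.prod isOpen_Ioi).mem_nhds hp))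
  refine tendsto_order.2 ⟨fun y hy => ?_, fun y hy => Eventually.of_forall fun N =>
    (mm_le f N p).trans_lt hy⟩
  obtain ⟨z, hz1, hz2⟩ := exists_between hy
  obtain ⟨ε, hε, hb⟩ := Metric.eventually_nhds_iff.1 (hc.eventually_const_lt hz2)
  filter_upwards [eventually_gt_atTop 0, eventually_gt_atTop (1 / ε), eventually_ge_atTop (1 / p.1),
    eventually_ge_atTop (1 / p.2)] with N hN0 hN1 hN2 hN3
  refine hz1.trans_le (le_iInf₂ fun q hq => (hb ?_).le)
  rw [div_lt_iff₀ hε] at hN1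
  rw [div_le_iff₀ hp1] at hN2
  rw [div_le_iff₀ hp2] at hN3
  have key : ∀ x y : ℝ, 1 ≤ N * x → ⌊y * N⌋₊ = ⌊x * N⌋₊ → |y - x| < ε := by
    intro x y h1 h2
    have h0 : 1 ≤ ⌊x * N⌋₊ := (Nat.one_le_floor_iff _).2 (by linarith)
    have h3 := Nat.floor_le (a := x * N) (by linarith)
    have h4 := Nat.lt_floor_add_one (x * N)
    have h5 : 1 ≤ y * N := (Nat.one_le_floor_iff _).1 (h2 ▸ h0)
    have h6 := Nat.floor_le (a := y * N) (by linarith)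
    have h7 := Nat.lt_floor_add_one (y * N)
    rw [h2] at h6 h7
    rw [abs_lt]
    constructor <;> nlinarith
  simp only [idx, Prod.mk.injEq] at hq
  rw [Prod.dist_eq, max_lt_iff, Real.dist_eq, Real.dist_eq]
  exact ⟨key _ _ hN2 hq.1, key _ _ hN3 hq.2⟩

lemma fatou_part (c ρ : ℝ) (hc : 0 < c) (hρ : 0 < ρ) (f : ℝ × ℝ → ℝ) (hf_nn : ∀ p, 0 ≤ f p)
    (hf_cont : ContinuousOn f (Set.Ioi 0 ×ˢ Set.Ioi 0)) (x : ENNReal)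
    (hx : x < ∫⁻ p in QQ, ENNReal.ofReal (f p) * ENNReal.ofReal (c * p.1 ^ ρ)) :
    ∃ N : ℝ, 0 < N ∧ x < ∑' i, mm f N i * (ENNReal.ofReal (i.1 / N) *
        (ENNReal.ofReal (1 / N) * ENNReal.ofReal (HH c ρ N i))) := by
  set F : ℕ → ℝ × ℝ → ENNReal := fun n p => mm f (n + 1) (idx (n + 1) p) *
    ENNReal.ofReal ((idx (n + 1) p).1 / ((n:ℝ) + 1)) * ENNReal.ofReal (c * p.1 ^ (ρ - 1)) with hF
  have hFm : ∀ n, Measurable (F n) := fun n =>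
    ((measurable_of_countable (fun i : ℕ × ℕ => mm f (n + 1) i *
      ENNReal.ofReal (i.1 / ((n:ℝ) + 1)))).comp (idx_meas _)).mul (by fun_prop)
  have hN : Tendsto (fun n : ℕ => (n:ℝ) + 1) atTop atTop :=
    tendsto_atTop_add_const_right _ _ tendsto_natCast_atTop_atTop
  have h1 : ∫⁻ p in QQ, ENNReal.ofReal (f p) * ENNReal.ofReal (c * p.1 ^ ρ) ≤
      ∫⁻ p in QQ, liminf (fun n => F n p) atTop := by
    apply setLIntegral_mono' QQ_meas
    intro p hp
    have hp1 : 0 < p.1 := hp.1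
    have l1 := (mm_lim f hf_cont p hp).comp hN
    have l2 := (ENNReal.continuous_ofReal.tendsto _).comp
      ((tendsto_nat_floor_mul_div_atTop hp1.le).comp hN)
    have l3 := ENNReal.Tendsto.mul_const (b := ENNReal.ofReal (c * p.1 ^ (ρ - 1))) (ENNReal.Tendsto.mul l1 (Or.inr ENNReal.ofReal_ne_top) l2
      (Or.inr ENNReal.ofReal_ne_top)) (Or.inr ENNReal.ofReal_ne_top)
    have l4 : Tendsto (fun n => F n p) atTop (nhds (ENNReal.ofReal (f p) * ENNReal.ofReal p.1 *
      ENNReal.ofReal (c * p.1 ^ (ρ - 1)))) := l3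
    rw [l4.liminf_eq, mul_assoc, ← ENNReal.ofReal_mul hp1.le]
    have e : c * p.1 ^ ρ = p.1 * (c * p.1 ^ (ρ - 1)) := by
      rw [Real.rpow_sub_one hp1.ne']; field_simp
    rw [e]
  have h2 := hx.trans_le (h1.trans (lintegral_liminf_le hFm))
  obtain ⟨n, hn⟩ := (eventually_lt_of_lt_liminf h2).exists
  exact ⟨(n:ℝ) + 1, by positivity, hn.trans_le (KK_lower c ρ hc hρ f _ (by positivity))⟩

lemma cobdd (μA : Measure ℝ) [IsProbabilityMeasure μA] (a : ℝ → ℝ) (c ρ : ℝ) (hρ : 0 < ρ)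
    (hμ : ∀ B : Set ℝ, MeasurableSet B → μA B = ∫⁻ p in B ∩ Set.Ioi 0, ENNReal.ofReal (a p))
    (htail : Tendsto (fun R : ℝ => R ^ ρ * μA.real (Set.Ioi R)) atTop (nhds (c / ρ))) :
    IsCoboundedUnder (· ≥ ·) atTop (fun r : ℝ => r ^ (ρ + 1) * a r) := by
  set K := 2 ^ (ρ + 1) * (|c / ρ| + 1) with hK
  have hKp : 0 < K := by positivity
  refine IsCoboundedUnder.of_frequently_le (a := K) ?_
  intro hcon
  have hcon : ∀ᶠ r : ℝ in atTop, K < r ^ (ρ + 1) * a r := hcon.mono fun r h => not_le.1 h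
  have ht := htail.eventually_lt_const (lt_of_le_of_lt (le_abs_self _) (lt_add_one _))
  obtain ⟨R0, hR0⟩ := eventually_atTop.1 hcon
  obtain ⟨R, hR, hRt, hRp⟩ := ((eventually_ge_atTop R0).and (ht.and (eventually_gt_atTop 0))).exists
  have h1 : ENNReal.ofReal (R * (K / (2 * R) ^ (ρ + 1))) ≤ μA (Set.Ioi R) := by
    rw [hμ _ measurableSet_Ioi]
    calc _ = ∫⁻ p in Set.Ioc R (2 * R), ENNReal.ofReal (K / (2 * R) ^ (ρ + 1)) := by
          rw [setLIntegral_const, Real.volume_Ioc, ← ENNReal.ofReal_mul (by positivity)]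
          congr 1; ring
      _ ≤ ∫⁻ p in Set.Ioc R (2 * R), ENNReal.ofReal (a p) := by
          apply setLIntegral_mono' measurableSet_Ioc
          intro r hr
          have hr0 : 0 < r := hRp.trans hr.1
          apply ENNReal.ofReal_le_ofReal
          have h2 := hR0 r (hR.trans hr.1.le)
          have h3 : r ^ (ρ + 1) ≤ (2 * R) ^ (ρ + 1) := Real.rpow_le_rpow hr0.le hr.2 (by linarith)
          have h4 : 0 < r ^ (ρ + 1) := Real.rpow_pos_of_pos hr0 _
          have h5 : 0 < a r := by
            by_contra! h
            nlinarith
          rw [div_le_iff₀ (by positivity)]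
          nlinarith
      _ ≤ _ := by
          apply lintegral_mono_set
          intro r hr
          exact ⟨hr.1, hRp.trans hr.1⟩
  have h2 : R * (K / (2 * R) ^ (ρ + 1)) ≤ μA.real (Set.Ioi R) :=
    (ENNReal.ofReal_le_iff_le_toReal (measure_ne_top _ _)).1 h1
  have h3 : R ^ ρ * (R * (K / (2 * R) ^ (ρ + 1))) = |c / ρ| + 1 := by
    rw [Real.mul_rpow (by norm_num) hRp.le, hK, Real.rpow_add hRp, Real.rpow_one]
    have := (Real.rpow_pos_of_pos hRp ρ).ne'
    have : (2:ℝ) ^ (ρ + 1) ≠ 0 := by positivity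
    field_simp
  have h4 := mul_le_mul_of_nonneg_left h2 (Real.rpow_pos_of_pos hRp ρ).le
  linarith

/-- For a fixed point `A` of the random affine equation `A =ᵈ A·U + V` with a
continuous density on `(0,∞)`, a pair `(U,V)` with a continuous density on `(0,∞)²`, a tail
behaving like `(c/ρ)·R^{-ρ}` and `E[U^ρ] = 1`, one has `liminf_{r→∞} r^{ρ+1} a(r) ≥ c`. -/
theorem stmt_2 {Ω : Type*} [MeasurableSpace Ω] (P : Measure Ω) [IsProbabilityMeasure P]
    (A U V : Ω → ℝ) (hA : Measurable A) (hU : Measurable U) (hV : Measurable V)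
    (hAnn : ∀ᵐ ω ∂P, 0 ≤ A ω)
    (hUVpos : ∀ᵐ ω ∂P, 0 < U ω ∧ 0 < V ω)
    (hindep : IndepFun A (fun ω => (U ω, V ω)) P)
    (a : ℝ → ℝ) (ha_meas : Measurable a) (ha_nn : ∀ r, 0 ≤ a r)
    (ha_cont : ContinuousOn a (Set.Ioi 0))
    (ha_dens : ∀ B : Set ℝ, MeasurableSet B →
      Measure.map A P B = ENNReal.ofReal (∫ r in B ∩ Set.Ioi 0, a r))
    (f : ℝ × ℝ → ℝ) (hf_meas : Measurable f) (hf_nn : ∀ p, 0 ≤ f p)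
    (hf_cont : ContinuousOn f (Set.Ioi 0 ×ˢ Set.Ioi 0))
    (hf_dens : ∀ B : Set (ℝ × ℝ), MeasurableSet B →
      Measure.map (fun ω => (U ω, V ω)) P B =
        ENNReal.ofReal (∫ p in B ∩ Set.Ioi 0 ×ˢ Set.Ioi 0, f p))
    (hfix : Measure.map (fun ω => A ω * U ω + V ω) P = Measure.map A P)
    (c ρ : ℝ) (hc : 0 < c) (hρ : 0 < ρ)
    (htail : Tendsto (fun R : ℝ => R ^ ρ * (P {ω | R < A ω}).toReal) atTop (nhds (c / ρ)))
    (hmom : ∫ ω, U ω ^ ρ ∂P = 1) :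
    c ≤ liminf (fun r : ℝ => r ^ (ρ + 1) * a r) atTop := by
  set μA := Measure.map A P with hμA
  set ν := Measure.map (fun ω => (U ω, V ω)) P with hν
  have hUV : Measurable fun ω => (U ω, V ω) := hU.prodMk hV
  have : IsProbabilityMeasure μA := Measure.isProbabilityMeasure_map hA.aemeasurable
  have : IsProbabilityMeasure ν := Measure.isProbabilityMeasure_map hUV.aemeasurable
  have hμ := (dens_lint volume μA a ha_nn _ ha_dens).2
  have hνd : ∀ B : Set (ℝ × ℝ), MeasurableSet B → ν B = ∫⁻ p in B ∩ QQ, ENNReal.ofReal (f p) :=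
    (dens_lint volume ν f hf_nn _ hf_dens).2
  have hpos : ∀ᵐ s ∂μA, 0 < s := by
    have h0 := ha_dens (Set.Iic 0) measurableSet_Iic
    have e : Set.Iic (0:ℝ) ∩ Set.Ioi 0 = ∅ := by ext x; simp
    rw [e] at h0
    simp only [Measure.restrict_empty, integral_zero_measure, ENNReal.ofReal_zero] at h0
    rw [ae_iff]
    convert h0 using 2
    ext x; simp
  have hfix' : Measure.map (fun q : ℝ × (ℝ × ℝ) => q.1 * q.2.1 + q.2.2) (μA.prod ν) = μA := by
    conv_rhs => rw [← hfix]
    rw [hμA, hν, ← (indepFun_iff_map_prod_eq_prod_map_map hA.aemeasurable hUV.aemeasurable).1 hindep,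
      Measure.map_map (by fun_prop) (by fun_prop)]
    rfl
  have htail' : Tendsto (fun R : ℝ => R ^ ρ * μA.real (Set.Ioi R)) atTop (nhds (c / ρ)) := by
    refine htail.congr fun R => ?_
    rw [Measure.real, hμA, Measure.map_apply hA measurableSet_Ioi]
    rfl
  have hνw : ν = (volume.restrict QQ).withDensity fun p => ENNReal.ofReal (f p) := by
    ext B hB
    rw [hνd B hB, withDensity_apply _ hB, Measure.restrict_restrict hB]
  have hmass : ∫⁻ p in QQ, ENNReal.ofReal (f p) * ENNReal.ofReal (c * p.1 ^ ρ) = ENNReal.ofReal c := by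
    have hfm : Measurable fun p => ENNReal.ofReal (f p) := by fun_prop
    have hgm : Measurable fun p : ℝ × ℝ => ENNReal.ofReal (c * p.1 ^ ρ) := by fun_prop
    have e1 := lintegral_withDensity_eq_lintegral_mul (volume.restrict QQ) hfm hgm
    refine Eq.trans e1.symm ?_
    rw [← hνw, hν, lintegral_map hgm hUV]
    have hint : Integrable (fun ω => U ω ^ ρ) P := by
      by_contra h
      rw [integral_undef h] at hmom
      exact zero_ne_one hmom
    rw [← ofReal_integral_eq_lintegral_ofReal (hint.const_mul c), integral_const_mul, hmom, mul_one]
    filter_upwards [hUVpos] with ω hω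
    have := hω.1
    simp only [Pi.zero_apply]; positivity
  refine le_of_forall_lt fun y hy => ?_
  obtain ⟨x, hx1, hx2⟩ := exists_between hy
  refine hx1.trans_le (le_liminf_of_le (cobdd μA a c ρ hρ hμ htail') ?_)
  have hxc : ENNReal.ofReal x < ENNReal.ofReal c := (ENNReal.ofReal_lt_ofReal_iff hc).2 hx2
  obtain ⟨N, hN, hNx⟩ := fatou_part c ρ hc hρ f hf_nn hf_cont (ENNReal.ofReal x) (by rwa [hmass])
  filter_upwards [sum_lim μA c ρ f htail' N hN _ hNx, eventually_gt_atTop 0] with r hr hr0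
  have h1 := dens_lower μA a ha_cont hμ r hr0 _
    (fun η hη hη1 => law_lower μA ν f hνd hpos hfix' N hN r η hr0 hη hη1)
  have h2 := hr.trans_le (mul_le_mul_right h1 _)
  rw [← ENNReal.ofReal_mul (by positivity)] at h2
  exact (ENNReal.ofReal_lt_ofReal_iff'.1 h2).1.le
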